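/- arXiv:1911.03566 — 5 statements merged into one kernel-verified Lean document; each statement's English description precedes it below -/
import Mathlib

section
/- Let G be an additive abelian group, P a type, and φ : P → G a function. Let H = {x : Multiset P | (x.map φ).sum = 0}, an additive submonoid of Multiset P, and let B = {y : Multiset G | (∀ g ∈ y, g ∈ Set.range φ) ∧ y.sum = 0}, an additive submonoid of Multiset G (the block monoid). Suppose A ∈ B is an atom of B and a : Multiset P satisfies a.map φ = A and φ is injective on the set of elements of a. Then a ∈ H, a is an atom of H, and for every n ≥ 1 the number of atoms of H dividing n•a in H equals the number of atoms of B dividing n•A in B; that is, a and A have the same divisor sequence. -/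
/-- `a` is an atom (irreducible element) of the additive submonoid `H`. -/
def IsAtomOf {M : Type*} [AddCommMonoid M] (H : AddSubmonoid M) (a : M) : Prop :=
  a ∈ H ∧ a ≠ 0 ∧ ∀ b c : M, b ∈ H → c ∈ H → a = b + c → b = 0 ∨ c = 0

/-- `b` divides `v` in the additive submonoid `H`. -/
def DividesIn {M : Type*} [AddCommMonoid M] (H : AddSubmonoid M) (b v : M) : Prop :=
  ∃ c ∈ H, v = b + c

/-- `sSeq H a n` is the number of atoms of `H` dividing `n • a` in `H`
(the `n`th entry of the divisor sequence of `a`). -/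
noncomputable def sSeq {M : Type*} [AddCommMonoid M] (H : AddSubmonoid M) (a : M) (n : ℕ) : ℕ :=
  {b : M | IsAtomOf H b ∧ DividesIn H b (n • a)}.ncard

/-- `H` is a full submonoid of `ι → ℕ`. -/
def IsFull {ι : Type*} (H : AddSubmonoid (ι → ℕ)) : Prop :=
  ∀ u ∈ H, ∀ v ∈ H, u ≤ v → v - u ∈ H

/-- Coordinatewise coercion `(ι → ℕ) → (ι → ℤ)`. -/
def natIntMap {ι : Type*} : (ι → ℕ) → (ι → ℤ) := fun f i => (f i : ℤ)

/-- `H` is a normal submonoid of `ι → ℕ`. -/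
def IsNormal {ι : Type*} (H : AddSubmonoid (ι → ℕ)) : Prop :=
  ∀ g : ι → ℤ, g ∈ AddSubgroup.closure (natIntMap '' (H : Set (ι → ℕ))) →
    (∃ N : ℕ, 1 ≤ N ∧ N • g ∈ natIntMap '' (H : Set (ι → ℕ))) →
    g ∈ natIntMap '' (H : Set (ι → ℕ))

/-- Outer (tensor) product of two vectors of naturals. -/
def outer {t₁ t₂ : ℕ} (u : Fin t₁ → ℕ) (v : Fin t₂ → ℕ) : Fin t₁ × Fin t₂ → ℕ :=
  fun p => u p.1 * v p.2

/-- The glom `G(H₁, H₂)`: the additive submonoid generated by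
`x₀ ⊠ y₀`, `xᵢ ⊠ y₀` and `x₀ ⊠ yⱼ`. -/
def glom {t₁ t₂ m n' : ℕ} (x : Fin (m + 1) → Fin t₁ → ℕ) (y : Fin (n' + 1) → Fin t₂ → ℕ) :
    AddSubmonoid (Fin t₁ × Fin t₂ → ℕ) :=
  AddSubmonoid.closure
    (Set.range (fun i => outer (x i) (y 0)) ∪ Set.range (fun j => outer (x 0) (y j)))

/-- An atom of a reduced multiplicative monoid. -/
def IsMulAtom {H : Type*} [CommMonoid H] (a : H) : Prop :=
  a ≠ 1 ∧ ∀ b c : H, a = b * c → b = 1 ∨ c = 1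

/-- The monoid `H` of multisets over `P` whose image under `φ` sums to zero. -/
def Hmon {P : Type*} {G : Type*} [AddCommGroup G] (φ : P → G) : AddSubmonoid (Multiset P) where
  carrier := {x | (x.map φ).sum = 0}
  zero_mem' := by simp
  add_mem' := by
    intro a b ha hb
    simp only [Set.mem_setOf_eq, Multiset.map_add, Multiset.sum_add] at *
    rw [ha, hb, add_zero]

/-- The block monoid of zero-sum multisets over `G` supported in `S`. -/
def Bmon {G : Type*} [AddCommGroup G] (S : Set G) : AddSubmonoid (Multiset G) where
  carrier := {y | (∀ g ∈ y, g ∈ S) ∧ y.sum = 0}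
  zero_mem' := by simp
  add_mem' := by
    intro a b ha hb
    refine ⟨fun g hg => ?_, ?_⟩
    · rcases Multiset.mem_add.mp hg with h | h
      exacts [ha.1 g h, hb.1 g h]
    · rw [Multiset.sum_add, ha.2, hb.2, add_zero]

/-- The block monoid `B(ℤ_n, {1, m})`. -/
def blockMon (n m : ℕ) : AddSubmonoid (Multiset (ZMod n)) where
  carrier := {A | (∀ g ∈ A, g = (1 : ZMod n) ∨ g = (m : ZMod n)) ∧ A.sum = 0}
  zero_mem' := by simp
  add_mem' := by
    intro a b ha hb
    refine ⟨fun g hg => ?_, ?_⟩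
    · rcases Multiset.mem_add.mp hg with h | h
      exacts [ha.1 g h, hb.1 g h]
    · rw [Multiset.sum_add, ha.2, hb.2, add_zero]

/-- The submonoid `{(x, y, z) ∈ ℕ³ : x + y = 2z}`. -/
def H19 : AddSubmonoid (ℕ × ℕ × ℕ) where
  carrier := {p | p.1 + p.2.1 = 2 * p.2.2}
  zero_mem' := by simp
  add_mem' := by
    intro p q hp hq
    simp only [Set.mem_setOf_eq, Prod.fst_add, Prod.snd_add] at *
    omega

theorem Multiset.exists_add_of_map_eq_add {α β : Type*} {f : α → β} {x : Multiset α}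
    {b c : Multiset β} (h : x.map f = b + c) :
    ∃ b' c' : Multiset α, x = b' + c' ∧ b'.map f = b ∧ c'.map f = c := by
  classical
  induction b using Multiset.induction_on generalizing x with
  | empty => exact ⟨0, x, by simp, by simp, by simpa using h⟩
  | cons g b ih =>
    rw [Multiset.cons_add, ← Multiset.map_eq_cons] at h
    obtain ⟨p, hp, hpg, hx⟩ := h
    obtain ⟨b', c', hbc, hb, hc⟩ := ih hx
    refine ⟨p ::ₘ b', c', ?_, by simp [hpg, hb], hc⟩
    rw [Multiset.cons_add, ← hbc, Multiset.cons_erase hp]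

theorem Multiset.injOn_map_of_injOn {α β : Type*} {f : α → β} {s : Set α} (hf : Set.InjOn f s) :
    Set.InjOn (Multiset.map f) {x | ∀ p ∈ x, p ∈ s} := by
  intro x hx y hy hxy
  rcases isEmpty_or_nonempty α with _ | _
  · exact Subsingleton.elim x y
  have key : ∀ z : Multiset α, (∀ p ∈ z, p ∈ s) →
      (z.map f).map (Function.invFunOn f s) = z := fun z hz => by
    rw [Multiset.map_map]
    exact (Multiset.map_congr rfl fun p hp => hf.leftInvOn_invFunOn (hz p hp)).trans
      (Multiset.map_id z)
  rw [← key x hx, ← key y hy, hxy]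

theorem map_mem_Bmon_iff {G : Type*} [AddCommGroup G] {P : Type*} {φ : P → G} {x : Multiset P} :
    x.map φ ∈ Bmon (Set.range φ) ↔ x ∈ Hmon φ := by
  refine ⟨fun h => h.2, fun h => ⟨fun g hg => ?_, h⟩⟩
  obtain ⟨p, -, rfl⟩ := Multiset.mem_map.mp hg
  exact Set.mem_range_self p

theorem isAtomOf_map_iff {G : Type*} [AddCommGroup G] {P : Type*} {φ : P → G} {x : Multiset P} :
    IsAtomOf (Bmon (Set.range φ)) (x.map φ) ↔ IsAtomOf (Hmon φ) x := by
  refine and_congr map_mem_Bmon_iff (and_congr (by simp) ⟨fun h b c hb hc hx => ?_,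
    fun h b c hb hc hx => ?_⟩)
  · simpa using h _ _ (map_mem_Bmon_iff.mpr hb) (map_mem_Bmon_iff.mpr hc)
      (by rw [hx, Multiset.map_add])
  · obtain ⟨b, c, hbc, rfl, rfl⟩ := Multiset.exists_add_of_map_eq_add hx
    simpa using h b c (map_mem_Bmon_iff.mp hb) (map_mem_Bmon_iff.mp hc) hbc

theorem sSeq_map {G : Type*} [AddCommGroup G] {P : Type*} {φ : P → G} {a : Multiset P}
    (hinj : Set.InjOn φ {p : P | p ∈ a}) (n : ℕ) :
    sSeq (Bmon (Set.range φ)) (a.map φ) n = sSeq (Hmon φ) a n := by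
  unfold sSeq
  have himage : {C | IsAtomOf (Bmon (Set.range φ)) C ∧
      DividesIn (Bmon (Set.range φ)) C (n • a.map φ)} =
      Multiset.map φ '' {b | IsAtomOf (Hmon φ) b ∧ DividesIn (Hmon φ) b (n • a)} := by
    ext C
    constructor
    · rintro ⟨hC, D, hD, h⟩
      rw [← Multiset.map_nsmul] at h
      obtain ⟨c, d, hcd, rfl, rfl⟩ := Multiset.exists_add_of_map_eq_add h
      exact ⟨c, ⟨isAtomOf_map_iff.mp hC, d, map_mem_Bmon_iff.mp hD, hcd⟩, rfl⟩
    · rintro ⟨b, ⟨hb, c, hc, h⟩, rfl⟩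
      exact ⟨isAtomOf_map_iff.mpr hb, c.map φ, map_mem_Bmon_iff.mpr hc, by
        rw [← Multiset.map_nsmul, h, Multiset.map_add]⟩
  rw [himage]
  refine Set.InjOn.ncard_image ((Multiset.injOn_map_of_injOn hinj).mono ?_)
  rintro b ⟨-, c, -, h⟩ p hp
  exact Multiset.mem_of_mem_nsmul (h ▸ Multiset.mem_add.mpr (Or.inl hp))

theorem block_monoid_atom_lift {G : Type*} [AddCommGroup G] {P : Type*} (φ : P → G)
    (A : Multiset G) (hA : A ∈ Bmon (Set.range φ)) (hAatom : IsAtomOf (Bmon (Set.range φ)) A)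
    (a : Multiset P) (hmap : a.map φ = A)
    (hinj : Set.InjOn φ {p : P | p ∈ a}) :
    a ∈ Hmon φ ∧ IsAtomOf (Hmon φ) a ∧
      ∀ n : ℕ, 1 ≤ n → sSeq (Hmon φ) a n = sSeq (Bmon (Set.range φ)) A n := by
  subst hmap
  exact ⟨map_mem_Bmon_iff.mp hA, isAtomOf_map_iff.mp hAatom, fun n _ => (sSeq_map hinj n).symm⟩
end

section
/- Let G be an additive abelian group, P a type, and φ : P → G a function. Let H = {x : Multiset P | (x.map φ).sum = 0}, an additive submonoid of Multiset P, and let B = {y : Multiset G | (∀ g ∈ y, g ∈ Set.range φ) ∧ y.sum = 0}, an additive submonoid of Multiset G (the block monoid). Then for every atom a of H and every n ≥ 1, the number of atoms of B dividing n•(a.map φ) in B is at most the number of atoms of H dividing n•a in H. -/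
theorem Multiset.exists_map_eq_of_map_eq_add {α β : Type*} (f : α → β) (s : Multiset α) :
    ∀ t u : Multiset β, s.map f = t + u → ∃ x y, s = x + y ∧ x.map f = t ∧ y.map f = u := by
  induction s using Multiset.induction_on with
  | empty =>
    intro t u h
    obtain ⟨rfl, rfl⟩ := add_eq_zero.mp (Multiset.map_zero f ▸ h).symm
    exact ⟨0, 0, by simp⟩
  | cons a s ih =>
    intro t u h
    rw [Multiset.map_cons] at h
    have hmem : f a ∈ t + u := h ▸ Multiset.mem_cons_self _ _
    rcases Multiset.mem_add.mp hmem with ht | hu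
    · obtain ⟨t', rfl⟩ := Multiset.exists_cons_of_mem ht
      rw [Multiset.cons_add, Multiset.cons_inj_right] at h
      obtain ⟨x, y, rfl, rfl, rfl⟩ := ih t' u h
      exact ⟨a ::ₘ x, y, by simp⟩
    · obtain ⟨u', rfl⟩ := Multiset.exists_cons_of_mem hu
      rw [Multiset.add_cons, Multiset.cons_inj_right] at h
      obtain ⟨x, y, rfl, rfl, rfl⟩ := ih t u' h
      exact ⟨x, a ::ₘ y, by simp⟩

theorem map_mem_Bmon {G P : Type*} [AddCommGroup G] {φ : P → G} {x : Multiset P}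
    (hx : x ∈ Hmon φ) : x.map φ ∈ Bmon (Set.range φ) := by
  refine ⟨fun g hg => ?_, hx⟩
  obtain ⟨p, -, rfl⟩ := Multiset.mem_map.mp hg
  exact ⟨p, rfl⟩

theorem IsAtomOf.of_map {G P : Type*} [AddCommGroup G] {φ : P → G} {x : Multiset P}
    (hx : IsAtomOf (Bmon (Set.range φ)) (x.map φ)) : IsAtomOf (Hmon φ) x := by
  refine ⟨hx.1.2, fun h => hx.2.1 (by simp [h]), fun b c hb hc h => ?_⟩
  simpa using hx.2.2 _ _ (map_mem_Bmon hb) (map_mem_Bmon hc) (by rw [h, Multiset.map_add])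

theorem block_monoid_divisor_sequence_le {G : Type*} [AddCommGroup G] {P : Type*} (φ : P → G)
    (a : Multiset P) (ha : IsAtomOf (Hmon φ) a) :
    ∀ n : ℕ, 1 ≤ n →
      sSeq (Bmon (Set.range φ)) (a.map φ) n ≤ sSeq (Hmon φ) a n := by
  intro n _
  have hfin : {b | IsAtomOf (Hmon φ) b ∧ DividesIn (Hmon φ) b (n • a)}.Finite := by
    classical
    refine (Set.finite_Iic (n • a)).subset ?_
    rintro b ⟨-, c, -, h⟩
    exact h ▸ Multiset.le_add_right b c
  refine (Set.ncard_le_ncard (t := Multiset.map φ '' _) ?_ (hfin.image _)).trans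
    (Set.ncard_image_le hfin)
  rintro b ⟨hb, d, hd, h⟩
  rw [← Multiset.map_nsmul] at h
  obtain ⟨x, y, hxy, rfl, rfl⟩ := Multiset.exists_map_eq_of_map_eq_add φ _ _ _ h
  exact ⟨x, ⟨hb.of_map, y, hd.2, hxy⟩, rfl⟩
end

section
/- Let m ≥ 3 be an odd integer and set n = (3m+1)/2. In the block monoid B(ℤ_n, {1, m}), the multiset a consisting of one copy of (1 : ZMod n) and three copies of (m : ZMod n) is an atom, and its divisor sequence satisfies s_i(a) = 1 for 1 ≤ i ≤ n − m − 1, s_i(a) = 3 for n − m ≤ i ≤ n − 1, and s_i(a) = 4 for all i ≥ n. -/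
/-- The multiset over `ZMod n` with `x` copies of `1` and `y` copies of `m`. -/
def blockPair (n m x y : ℕ) : Multiset (ZMod n) :=
  Multiset.replicate x (1 : ZMod n) + Multiset.replicate y (m : ZMod n)

theorem blockPair_add (n m x y x' y' : ℕ) :
    blockPair n m x y + blockPair n m x' y' = blockPair n m (x + x') (y + y') := by
  simp only [blockPair, Multiset.replicate_add]
  abel

theorem nsmul_blockPair (n m i x y : ℕ) :
    i • blockPair n m x y = blockPair n m (i * x) (i * y) := by
  simp [blockPair, Multiset.nsmul_replicate]

theorem blockPair_zero_zero (n m : ℕ) : blockPair n m 0 0 = 0 := by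
  simp [blockPair]

theorem exists_eq_blockPair {n m : ℕ} {b : Multiset (ZMod n)}
    (hb : ∀ g ∈ b, g = (1 : ZMod n) ∨ g = (m : ZMod n)) : ∃ x y, b = blockPair n m x y := by
  induction b using Multiset.induction_on with
  | empty => exact ⟨0, 0, (blockPair_zero_zero n m).symm⟩
  | cons g b ih =>
    obtain ⟨x, y, rfl⟩ := ih fun g hg => hb g (Multiset.mem_cons_of_mem hg)
    rcases hb g (Multiset.mem_cons_self _ _) with rfl | rfl
    · exact ⟨x + 1, y, by simp [blockPair, Multiset.replicate_succ]⟩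
    · exact ⟨x, y + 1, by simp [blockPair, Multiset.replicate_succ]⟩

theorem blockPair_mem_iff_dvd (n m x y : ℕ) :
    blockPair n m x y ∈ blockMon n m ↔ n ∣ x + y * m := by
  rw [← ZMod.natCast_eq_zero_iff]
  change (∀ g ∈ blockPair n m x y, _) ∧ (blockPair n m x y).sum = 0 ↔ _
  have hsupp : ∀ g ∈ blockPair n m x y, g = (1 : ZMod n) ∨ g = (m : ZMod n) := by
    intro g hg
    rcases Multiset.mem_add.mp hg with h | h
    exacts [.inl (Multiset.eq_of_mem_replicate h), .inr (Multiset.eq_of_mem_replicate h)]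
  rw [and_iff_right hsupp]
  simp [blockPair]

theorem blockPair_inj {n m : ℕ} (h : (1 : ZMod n) ≠ m) {x y x' y' : ℕ} :
    blockPair n m x y = blockPair n m x' y' ↔ x = x' ∧ y = y' := by
  refine ⟨fun e => ?_, fun e => by rw [e.1, e.2]⟩
  have h1 := congrArg (Multiset.count (1 : ZMod n)) e
  have h2 := congrArg (Multiset.count (m : ZMod n)) e
  simp only [blockPair, Multiset.count_add, Multiset.count_replicate, if_neg h, if_neg h.symm,
    if_true] at h1 h2
  omega

theorem one_ne_natCast_zmod {k : ℕ} (hk : 1 ≤ k) :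
    (1 : ZMod (3 * k + 2)) ≠ ((2 * k + 1 : ℕ) : ZMod (3 * k + 2)) := by
  intro h
  have h' : ((1 : ℕ) : ZMod (3 * k + 2)) = ((2 * k + 1 : ℕ) : ZMod (3 * k + 2)) := by
    rw [← h, Nat.cast_one]
  rw [ZMod.natCast_eq_natCast_iff', Nat.mod_eq_of_lt (by omega), Nat.mod_eq_of_lt (by omega)] at h'
  omega

theorem blockPair_mem_iff {k x y : ℕ} :
    blockPair (3 * k + 2) (2 * k + 1) x y ∈ blockMon (3 * k + 2) (2 * k + 1) ↔
      ∃ t : ℤ, (y : ℤ) = 3 * x + (3 * k + 2) * t := by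
  rw [blockPair_mem_iff_dvd, ← Int.natCast_dvd_natCast]
  push_cast
  constructor
  · rintro ⟨t, ht⟩
    exact ⟨2 * y - 3 * t, by linear_combination -3 * ht⟩
  · rintro ⟨t, ht⟩
    exact ⟨2 * x + t * (2 * k + 1), by linear_combination (2 * k + 1) * ht⟩

theorem dividesIn_blockPair_iff {k x y x' y' : ℕ} (hk : 1 ≤ k)
    (h : blockPair (3 * k + 2) (2 * k + 1) x y ∈ blockMon (3 * k + 2) (2 * k + 1))
    (h' : blockPair (3 * k + 2) (2 * k + 1) x' y' ∈ blockMon (3 * k + 2) (2 * k + 1)) :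
    DividesIn (blockMon (3 * k + 2) (2 * k + 1)) (blockPair (3 * k + 2) (2 * k + 1) x y)
      (blockPair (3 * k + 2) (2 * k + 1) x' y') ↔ x ≤ x' ∧ y ≤ y' := by
  constructor
  · rintro ⟨c, hc, e⟩
    obtain ⟨u, v, rfl⟩ := exists_eq_blockPair hc.1
    rw [blockPair_add, blockPair_inj (one_ne_natCast_zmod hk)] at e
    omega
  · rintro ⟨hx, hy⟩
    refine ⟨blockPair _ (2 * k + 1) (x' - x) (y' - y), ?_, ?_⟩
    · rw [blockPair_mem_iff] at *
      obtain ⟨s, hs⟩ := h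
      obtain ⟨t, ht⟩ := h'
      exact ⟨t - s, by push_cast [hx, hy]; linear_combination ht - hs⟩
    · rw [blockPair_add, Nat.add_sub_cancel' hx, Nat.add_sub_cancel' hy]

/-- Atoms are the nonzero elements that are minimal for divisibility. -/
theorem isAtomOf_blockPair_iff_minimal {k x y : ℕ} (hk : 1 ≤ k) :
    IsAtomOf (blockMon (3 * k + 2) (2 * k + 1)) (blockPair (3 * k + 2) (2 * k + 1) x y) ↔
      blockPair (3 * k + 2) (2 * k + 1) x y ∈ blockMon (3 * k + 2) (2 * k + 1) ∧
      ¬(x = 0 ∧ y = 0) ∧ ∀ u v : ℕ,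
        blockPair (3 * k + 2) (2 * k + 1) u v ∈ blockMon (3 * k + 2) (2 * k + 1) →
        ¬(u = 0 ∧ v = 0) → u ≤ x → v ≤ y → u = x ∧ v = y := by
  have inj := @blockPair_inj _ _ (one_ne_natCast_zmod hk)
  have zero_iff : ∀ u v, blockPair (3 * k + 2) (2 * k + 1) u v = 0 ↔ u = 0 ∧ v = 0 := fun u v => by
    rw [← blockPair_zero_zero (3 * k + 2) (2 * k + 1), inj]
  constructor
  · rintro ⟨hmem, hne, hirr⟩
    refine ⟨hmem, by rwa [Ne, zero_iff] at hne, fun u v huv h0 hu hv => ?_⟩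
    obtain ⟨c, hc, e⟩ := (dividesIn_blockPair_iff hk huv hmem).mpr ⟨hu, hv⟩
    rcases hirr _ _ huv hc e with h | h
    · exact absurd ((zero_iff u v).mp h) h0
    · rw [h, add_zero, inj] at e
      omega
  · rintro ⟨hmem, hne, hmin⟩
    refine ⟨hmem, by rwa [Ne, zero_iff], fun b c hb hc e => ?_⟩
    obtain ⟨u, v, rfl⟩ := exists_eq_blockPair hb.1
    obtain ⟨u', v', rfl⟩ := exists_eq_blockPair hc.1
    rw [blockPair_add, inj] at e
    rw [zero_iff, zero_iff, or_iff_not_imp_left]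
    intro h
    have := hmin u v hb h (by omega) (by omega)
    omega

theorem isAtomOf_blockPair_iff {k x y : ℕ} (hk : 1 ≤ k) :
    IsAtomOf (blockMon (3 * k + 2) (2 * k + 1)) (blockPair (3 * k + 2) (2 * k + 1) x y) ↔
      (x = 1 ∧ y = 3) ∨ (x = k + 1 ∧ y = 1) ∨ (x = 0 ∧ y = 3 * k + 2) ∨
        (x = 3 * k + 2 ∧ y = 0) := by
  rw [isAtomOf_blockPair_iff_minimal hk]
  simp only [blockPair_mem_iff]
  constructor
  · rintro ⟨⟨t, ht⟩, hne, hmin⟩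
    by_cases hxy : 1 ≤ x ∧ 3 ≤ y
    · have := hmin 1 3 ⟨0, by norm_num⟩ (by omega) hxy.1 hxy.2
      omega
    have hn : (0 : ℤ) < 3 * k + 2 := by omega
    by_cases hx : x = 0
    · subst hx
      have htpos : 0 < t := by
        by_contra! h
        have : (3 * k + 2 : ℤ) * t ≤ 0 := mul_nonpos_of_nonneg_of_nonpos hn.le h
        omega
      have : (3 * k + 2 : ℤ) ≤ y := by push_cast at ht; nlinarith
      have := hmin 0 (3 * k + 2) ⟨1, by push_cast; ring⟩ (by omega) (by omega) (by omega)
      omega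
    have hy : y ≤ 2 := by omega
    have htneg : t < 0 := by
      by_contra! h
      have : 0 ≤ (3 * k + 2 : ℤ) * t := mul_nonneg hn.le h
      omega
    by_cases hy0 : y = 0
    · subst hy0
      obtain ⟨s, hs⟩ : (3 : ℤ) ∣ t := by
        have h3 : (3 : ℤ) ∣ 2 * t := ⟨-x - k * t, by push_cast at ht; linear_combination -ht⟩
        omega
      have : (3 * k + 2 : ℤ) ≤ x := by
        subst hs
        have hx' : (x : ℤ) = (3 * k + 2) * -s := by push_cast at ht; linarith
        have hs' : 1 ≤ -s := by omega
        nlinarith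
      have := hmin (3 * k + 2) 0 ⟨-3, by push_cast; ring⟩ (by omega) (by omega) (by omega)
      omega
    · have : (k + 1 : ℤ) ≤ x := by
        have : (3 * k + 2 : ℤ) * t ≤ -(3 * k + 2) := by nlinarith
        omega
      have := hmin (k + 1) 1 ⟨-1, by push_cast; ring⟩ (by omega) (by omega) (by omega)
      omega
  · have small : ∀ t d : ℤ, d = (3 * k + 2) * t → -(3 * k + 2) < d → d < 3 * k + 2 → d = 0 := by
      intro t d hd h1 h2
      exact Int.eq_zero_of_abs_lt_dvd ⟨t, hd⟩ (abs_lt.mpr ⟨h1, h2⟩)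
    rintro (⟨rfl, rfl⟩ | ⟨rfl, rfl⟩ | ⟨rfl, rfl⟩ | ⟨rfl, rfl⟩)
    · refine ⟨⟨0, by norm_num⟩, by omega, ?_⟩
      rintro u v ⟨t, ht⟩ hne hu hv
      have := small t (v - 3 * u) (by linear_combination ht) (by omega) (by omega)
      omega
    · refine ⟨⟨-1, by push_cast; ring⟩, by omega, ?_⟩
      rintro u v ⟨t, ht⟩ hne hu hv
      by_cases hu' : u = k + 1
      · subst hu'
        have := small (t + 1) (v - 1) (by push_cast at ht; linear_combination ht) (by omega)
          (by omega)
        omega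
      · have := small t (v - 3 * u) (by linear_combination ht) (by omega) (by omega)
        omega
    · refine ⟨⟨1, by push_cast; ring⟩, by omega, ?_⟩
      rintro u v ⟨t, ht⟩ hne hu hv
      have := small (t - 1) (v - (3 * k + 2)) (by
        obtain rfl : u = 0 := by omega
        push_cast at ht; linear_combination ht) (by omega) (by omega)
      omega
    · refine ⟨⟨-3, by push_cast; ring⟩, by omega, ?_⟩
      rintro u v ⟨t, ht⟩ hne hu hv
      obtain rfl : v = 0 := by omega
      obtain ⟨s, hs⟩ : (3 : ℤ) ∣ t := by
        have h3 : (3 : ℤ) ∣ 2 * t := ⟨-u - k * t, by push_cast at ht; linear_combination -ht⟩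
        omega
      subst hs
      have := small (-s - 1) (u - (3 * k + 2)) (by push_cast at ht; linarith) (by omega) (by omega)
      omega

theorem sSeq_blockPair_one_three {k i : ℕ} (hk : 1 ≤ k) {s : Finset (ℕ × ℕ)}
    (hs : ∀ x y, (x, y) ∈ s ↔ ((x = 1 ∧ y = 3) ∨ (x = k + 1 ∧ y = 1) ∨
      (x = 0 ∧ y = 3 * k + 2) ∨ (x = 3 * k + 2 ∧ y = 0)) ∧ x ≤ i ∧ y ≤ i * 3) :
    sSeq (blockMon (3 * k + 2) (2 * k + 1)) (blockPair (3 * k + 2) (2 * k + 1) 1 3) i = s.card := by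
  have hset : {b | IsAtomOf (blockMon (3 * k + 2) (2 * k + 1)) b ∧
      DividesIn (blockMon (3 * k + 2) (2 * k + 1)) b
        (i • blockPair (3 * k + 2) (2 * k + 1) 1 3)} =
      (fun p : ℕ × ℕ => blockPair (3 * k + 2) (2 * k + 1) p.1 p.2) '' (s : Set (ℕ × ℕ)) := by
    have hmul : blockPair (3 * k + 2) (2 * k + 1) i (i * 3) ∈ blockMon (3 * k + 2) (2 * k + 1) :=
      blockPair_mem_iff.mpr ⟨0, by push_cast; ring⟩
    rw [nsmul_blockPair, mul_one]
    ext b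
    constructor
    · rintro ⟨hb, hdvd⟩
      obtain ⟨x, y, rfl⟩ := exists_eq_blockPair hb.1.1
      rw [dividesIn_blockPair_iff hk hb.1 hmul] at hdvd
      exact ⟨(x, y), (hs x y).mpr ⟨(isAtomOf_blockPair_iff hk).mp hb, hdvd⟩, rfl⟩
    · rintro ⟨⟨x, y⟩, hxy, rfl⟩
      obtain ⟨h1, h2⟩ := (hs x y).mp hxy
      have hatom := (isAtomOf_blockPair_iff hk).mpr h1
      exact ⟨hatom, (dividesIn_blockPair_iff hk hatom.1 hmul).mpr h2⟩
  rw [sSeq, hset, Set.ncard_image_of_injective, Set.ncard_coe_finset]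
  rintro ⟨x, y⟩ ⟨x', y'⟩ h
  exact Prod.ext_iff.mpr ((blockPair_inj (one_ne_natCast_zmod hk)).mp h)

theorem block_monoid_example_one_m_cubed (m : ℕ) (hm_odd : Odd m) (hm : 3 ≤ m) :
    ∀ n : ℕ, n = (3 * m + 1) / 2 →
      ∀ a : Multiset (ZMod n), a = (1 : ZMod n) ::ₘ Multiset.replicate 3 (m : ZMod n) →
        a ∈ blockMon n m ∧ IsAtomOf (blockMon n m) a ∧
        (∀ i : ℕ, 1 ≤ i → i ≤ n - m - 1 → sSeq (blockMon n m) a i = 1) ∧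
        (∀ i : ℕ, n - m ≤ i → i ≤ n - 1 → sSeq (blockMon n m) a i = 3) ∧
        (∀ i : ℕ, n ≤ i → sSeq (blockMon n m) a i = 4) := by
  obtain ⟨k, rfl⟩ := hm_odd
  intro n hn a ha
  obtain rfl : n = 3 * k + 2 := by omega
  have hk : 1 ≤ k := by omega
  obtain rfl : a = blockPair (3 * k + 2) (2 * k + 1) 1 3 := by
    rw [ha, blockPair, Multiset.replicate_one, Multiset.singleton_add]
  have hatom := (isAtomOf_blockPair_iff hk).mpr (.inl ⟨rfl, rfl⟩)
  refine ⟨hatom.1, hatom, fun i h1 h2 => ?_, fun i h1 h2 => ?_, fun i h1 => ?_⟩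
  · rw [sSeq_blockPair_one_three hk (s := {(1, 3)})]
    · simp
    · intro x y
      simp only [Finset.mem_singleton, Prod.mk.injEq]
      omega
  · rw [sSeq_blockPair_one_three hk (s := {(1, 3), (k + 1, 1), (0, 3 * k + 2)})]
    · rw [Finset.card_eq_three]
      exact ⟨_, _, _, by simp, by simp, by simp, rfl⟩
    · intro x y
      simp only [Finset.mem_insert, Finset.mem_singleton, Prod.mk.injEq]
      omega
  · rw [sSeq_blockPair_one_three hk (s := {(1, 3), (k + 1, 1), (0, 3 * k + 2), (3 * k + 2, 0)})]
    · rw [Finset.card_insert_of_notMem (by simp), Finset.card_eq_three.mpr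
        ⟨_, _, _, by simp, by simp, by simp, rfl⟩]
    · intro x y
      simp only [Finset.mem_insert, Finset.mem_singleton, Prod.mk.injEq]
      omega
end

section
/- Let m ≥ 3 be an odd integer and set n = (3m+1)/2. In the block monoid B(ℤ_n, {1, m}), the multiset b consisting of n − m copies of (1 : ZMod n) and one copy of (m : ZMod n) is an atom, and its divisor sequence satisfies s_1(b) = 1, s_2(b) = 1, s_i(b) = 3 for 3 ≤ i ≤ n − 1, and s_i(b) = 4 for all i ≥ n. -/
/-- The multiset over `ZMod n` with `p.1` copies of `1` and `p.2` copies of `m`. -/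
def onesAndMs (n m : ℕ) (p : ℕ × ℕ) : Multiset (ZMod n) :=
  Multiset.replicate p.1 1 + Multiset.replicate p.2 (m : ZMod n)

lemma onesAndMs_add (n m : ℕ) (p q : ℕ × ℕ) :
    onesAndMs n m (p + q) = onesAndMs n m p + onesAndMs n m q := by
  simp only [onesAndMs, Prod.fst_add, Prod.snd_add, Multiset.replicate_add]
  abel

lemma onesAndMs_zero (n m : ℕ) : onesAndMs n m 0 = 0 := by
  simp [onesAndMs]

lemma onesAndMs_nsmul (n m i : ℕ) (p : ℕ × ℕ) :
    onesAndMs n m (i • p) = i • onesAndMs n m p := by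
  simp [onesAndMs, Multiset.nsmul_replicate]

lemma onesAndMs_injective {n m : ℕ} (h : (m : ZMod n) ≠ 1) :
    Function.Injective (onesAndMs n m) := by
  intro p q hpq
  have h1 := congrArg (Multiset.count 1) hpq
  have h2 := congrArg (Multiset.count (m : ZMod n)) hpq
  simp only [onesAndMs, Multiset.count_add, Multiset.count_replicate, if_neg h, if_neg h.symm,
    if_true, add_zero, zero_add] at h1 h2
  exact Prod.ext h1 h2

lemma onesAndMs_mem_blockMon {n m : ℕ} (p : ℕ × ℕ) :
    onesAndMs n m p ∈ blockMon n m ↔ n ∣ p.1 + p.2 * m := by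
  change (_ ∧ _) ↔ _
  rw [← ZMod.natCast_eq_zero_iff]
  have hsum : (onesAndMs n m p).sum = ((p.1 + p.2 * m : ℕ) : ZMod n) := by
    simp [onesAndMs]
  rw [hsum, and_iff_right_iff_imp]
  intro _ g hg
  exact (Multiset.mem_add.mp hg).imp Multiset.eq_of_mem_replicate Multiset.eq_of_mem_replicate

lemma exists_eq_onesAndMs {n m : ℕ} {A : Multiset (ZMod n)} (hA : A ∈ blockMon n m) :
    ∃ p, A = onesAndMs n m p := by
  have hsupp : ∀ g ∈ A, g = (1 : ZMod n) ∨ g = (m : ZMod n) := hA.1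
  clear hA
  induction A using Multiset.induction_on with
  | empty => exact ⟨0, (onesAndMs_zero n m).symm⟩
  | cons a A ih =>
    obtain ⟨p, rfl⟩ := ih fun g hg => hsupp g (Multiset.mem_cons_of_mem hg)
    rcases hsupp a (Multiset.mem_cons_self _ _) with rfl | rfl
    · exact ⟨(1, 0) + p, by rw [onesAndMs_add]; simp [onesAndMs]⟩
    · exact ⟨(0, 1) + p, by rw [onesAndMs_add]; simp [onesAndMs]⟩

/-- `onesAndMs n m p` is an atom iff `p` is minimal among the nonzero pairs of exponents of
zero-sum multisets. -/
lemma isAtomOf_onesAndMs {n m : ℕ} (h : (m : ZMod n) ≠ 1) (p : ℕ × ℕ) :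
    IsAtomOf (blockMon n m) (onesAndMs n m p) ↔
      Minimal (fun q : ℕ × ℕ => n ∣ q.1 + q.2 * m ∧ q ≠ 0) p := by
  have hz : ∀ q, onesAndMs n m q = 0 ↔ q = 0 := fun q => by
    rw [← onesAndMs_zero n m, (onesAndMs_injective h).eq_iff]
  constructor
  · rintro ⟨hp, hp0, hmin⟩
    rw [onesAndMs_mem_blockMon] at hp
    refine ⟨⟨hp, by rwa [ne_eq, ← hz]⟩, ?_⟩
    rintro q ⟨hq, hq0⟩ hqp
    obtain ⟨r, rfl⟩ := exists_add_of_le hqp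
    have hr : n ∣ r.1 + r.2 * m := by
      rw [← Nat.dvd_add_right hq]
      convert hp using 1
      simp only [Prod.fst_add, Prod.snd_add]
      ring
    rcases hmin _ _ ((onesAndMs_mem_blockMon q).2 hq) ((onesAndMs_mem_blockMon r).2 hr)
      (onesAndMs_add n m q r) with h0 | h0
    · exact absurd ((hz q).1 h0) hq0
    · simp [(hz r).1 h0]
  · rintro ⟨⟨hp, hp0⟩, hmin⟩
    refine ⟨(onesAndMs_mem_blockMon p).2 hp, by rwa [ne_eq, hz], ?_⟩
    intro B C hB hC hBC
    obtain ⟨q, rfl⟩ := exists_eq_onesAndMs hB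
    obtain ⟨r, rfl⟩ := exists_eq_onesAndMs hC
    rw [← onesAndMs_add] at hBC
    obtain rfl := onesAndMs_injective h hBC
    rw [hz, hz, or_iff_not_imp_left]
    intro hq0
    have := hmin ⟨(onesAndMs_mem_blockMon q).1 hB, hq0⟩ le_self_add
    simpa using this

lemma dividesIn_onesAndMs {n m : ℕ} (h : (m : ZMod n) ≠ 1) {p q : ℕ × ℕ}
    (hp : onesAndMs n m p ∈ blockMon n m) (hq : onesAndMs n m q ∈ blockMon n m) :
    DividesIn (blockMon n m) (onesAndMs n m p) (onesAndMs n m q) ↔ p ≤ q := by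
  constructor
  · rintro ⟨C, hC, hqC⟩
    obtain ⟨r, rfl⟩ := exists_eq_onesAndMs hC
    rw [← onesAndMs_add] at hqC
    obtain rfl := onesAndMs_injective h hqC
    exact le_self_add
  · intro hpq
    obtain ⟨r, rfl⟩ := exists_add_of_le hpq
    refine ⟨onesAndMs n m r, ?_, onesAndMs_add n m p r⟩
    rw [onesAndMs_mem_blockMon] at *
    rw [← Nat.dvd_add_right hp]
    convert hq using 1
    simp only [Prod.fst_add, Prod.snd_add]
    ring

lemma sSeq_onesAndMs {n m : ℕ} (h : (m : ZMod n) ≠ 1) {p : ℕ × ℕ}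
    (hp : onesAndMs n m p ∈ blockMon n m) (i : ℕ) :
    sSeq (blockMon n m) (onesAndMs n m p) i =
      {q | Minimal (fun q : ℕ × ℕ => n ∣ q.1 + q.2 * m ∧ q ≠ 0) q ∧ q ≤ i • p}.ncard := by
  rw [← Set.ncard_image_of_injective _ (onesAndMs_injective h), sSeq]
  congr 1
  have hip : onesAndMs n m (i • p) ∈ blockMon n m := by
    rw [onesAndMs_nsmul]
    exact nsmul_mem hp i
  ext B
  simp only [Set.mem_ofPred_eq, Set.mem_image, ← onesAndMs_nsmul]
  constructor
  · rintro ⟨hB, hdvd⟩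
    obtain ⟨q, rfl⟩ := exists_eq_onesAndMs hB.1
    exact ⟨q, ⟨(isAtomOf_onesAndMs h q).1 hB, (dividesIn_onesAndMs h hB.1 hip).1 hdvd⟩, rfl⟩
  · rintro ⟨q, ⟨hq, hle⟩, rfl⟩
    have hat := (isAtomOf_onesAndMs h q).2 hq
    exact ⟨hat, (dividesIn_onesAndMs h hat.1 hip).2 hle⟩

lemma dvd_add_mul_iff (k x y : ℕ) :
    3 * k + 2 ∣ x + y * (2 * k + 1) ↔ ∃ c : ℤ, 3 * (x : ℤ) - y = (3 * k + 2) * c := by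
  rw [← Int.natCast_dvd_natCast]
  push_cast
  constructor
  · rintro ⟨c, hc⟩
    exact ⟨3 * c - 2 * y, by linear_combination 3 * hc⟩
  · rintro ⟨c, hc⟩
    exact ⟨(k + 1) * c - x + y, by linear_combination (k + 1) * hc⟩

/-- The four atoms of `B(ℤ_n, {1, m})` for `m = 2 * k + 1` and `n = 3 * k + 2`. -/
lemma minimal_exponents_iff {k : ℕ} (hk : 1 ≤ k) (p : ℕ × ℕ) :
    Minimal (fun q : ℕ × ℕ => 3 * k + 2 ∣ q.1 + q.2 * (2 * k + 1) ∧ q ≠ 0) p ↔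
      p = (3 * k + 2, 0) ∨ p = (k + 1, 1) ∨ p = (1, 3) ∨ p = (0, 3 * k + 2) := by
  simp only [dvd_add_mul_iff]
  constructor
  · rintro ⟨⟨⟨c, hc⟩, hp0⟩, hmin⟩
    obtain ⟨x, y⟩ := p
    have key : ∀ a b : ℕ, (∃ c : ℤ, 3 * (a : ℤ) - b = (3 * k + 2) * c) → (a, b) ≠ (0, 0) →
        a ≤ x → b ≤ y → (x, y) = (a, b) := fun a b hab h0 ha hb =>
      le_antisymm (hmin (y := (a, b)) ⟨hab, h0⟩ ⟨ha, hb⟩) ⟨ha, hb⟩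
    have k1 := key (3 * k + 2) 0 ⟨3, by push_cast; ring⟩ (by simp)
    have k2 := key (k + 1) 1 ⟨1, by push_cast; ring⟩ (by simp)
    have k3 := key 1 3 ⟨0, by push_cast; ring⟩ (by simp)
    have k4 := key 0 (3 * k + 2) ⟨-1, by push_cast; ring⟩ (by simp)
    simp only [ne_eq, Prod.mk_eq_zero, Prod.mk.injEq] at *
    have hc1 : 0 < c → (3 * k + 2 : ℤ) ≤ 3 * x - y := fun h => by rw [hc]; nlinarith
    have hc2 : c < 0 → 3 * x - y ≤ (-(3 * k + 2) : ℤ) := fun h => by rw [hc]; nlinarith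
    have hc3 : c = 0 → (3 * x - y : ℤ) = 0 := fun h => by rw [hc, h]; simp
    rcases lt_trichotomy c 0 with h | h | h
    · specialize hc2 h
      omega
    · specialize hc3 h
      omega
    · specialize hc1 h
      by_cases h2 : c = 1
      · subst h2
        omega
      · by_cases h3 : c = 2
        · subst h3
          omega
        · have : (3 * (3 * k + 2) : ℤ) ≤ 3 * x - y := by
            have : 3 ≤ c := by omega
            rw [hc]
            nlinarith
          omega
  · intro hp
    have hnonzero : p ≠ 0 := by
      rcases hp with rfl | rfl | rfl | rfl <;> simp
    refine ⟨⟨?_, hnonzero⟩, ?_⟩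
    · rcases hp with rfl | rfl | rfl | rfl
      exacts [⟨3, by push_cast; ring⟩, ⟨1, by push_cast; ring⟩, ⟨0, by push_cast; ring⟩,
        ⟨-1, by push_cast; ring⟩]
    · rintro ⟨x, y⟩ ⟨⟨c, hc⟩, hq0⟩ ⟨hx, hy⟩
      simp only [ne_eq, Prod.mk_eq_zero] at *
      have hlow : -1 ≤ c := by
        by_contra! h
        have : (3 * k + 2 : ℤ) * c ≤ -2 * (3 * k + 2) := by nlinarith
        rcases hp with rfl | rfl | rfl | rfl <;> simp only at hx hy <;> omega
      have hhigh : c ≤ 3 := by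
        by_contra! h
        have : 4 * (3 * k + 2) ≤ (3 * k + 2 : ℤ) * c := by nlinarith
        rcases hp with rfl | rfl | rfl | rfl <;> simp only at hx hy <;> omega
      rw [Prod.le_def]
      interval_cases c <;> rcases hp with rfl | rfl | rfl | rfl <;>
        simp only at hx hy ⊢ <;> omega

theorem block_monoid_example_ones_m (m : ℕ) (hm_odd : Odd m) (hm : 3 ≤ m) :
    ∀ n : ℕ, n = (3 * m + 1) / 2 →
      ∀ b : Multiset (ZMod n), b = (m : ZMod n) ::ₘ Multiset.replicate (n - m) (1 : ZMod n) →
        b ∈ blockMon n m ∧ IsAtomOf (blockMon n m) b ∧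
        sSeq (blockMon n m) b 1 = 1 ∧
        sSeq (blockMon n m) b 2 = 1 ∧
        (∀ i : ℕ, 3 ≤ i → i ≤ n - 1 → sSeq (blockMon n m) b i = 3) ∧
        (∀ i : ℕ, n ≤ i → sSeq (blockMon n m) b i = 4) := by
  obtain ⟨k, rfl⟩ := hm_odd
  have hk : 1 ≤ k := by omega
  intro n hn b hb
  obtain rfl : n = 3 * k + 2 := by omega
  have hne : ((2 * k + 1 : ℕ) : ZMod (3 * k + 2)) ≠ 1 := by
    rw [ne_eq, ← Nat.cast_one (R := ZMod (3 * k + 2)), ZMod.natCast_eq_natCast_iff', Nat.mod_eq_of_lt (by omega),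
      Nat.mod_eq_of_lt (by omega)]
    omega
  obtain rfl : b = onesAndMs (3 * k + 2) (2 * k + 1) (k + 1, 1) := by
    rw [hb, show 3 * k + 2 - (2 * k + 1) = k + 1 by omega, onesAndMs, Multiset.replicate_one,
      add_comm (Multiset.replicate _ _), Multiset.singleton_add]
  have hatom : IsAtomOf (blockMon (3 * k + 2) (2 * k + 1))
      (onesAndMs (3 * k + 2) (2 * k + 1) (k + 1, 1)) := by
    simp [isAtomOf_onesAndMs hne, minimal_exponents_iff hk]
  refine ⟨hatom.1, hatom, ?_⟩
  simp only [sSeq_onesAndMs hne hatom.1, minimal_exponents_iff hk]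
  have hset : ∀ (i : ℕ) (s : Finset (ℕ × ℕ)),
      (∀ q, q ∈ s ↔ (q = (3 * k + 2, 0) ∨ q = (k + 1, 1) ∨ q = (1, 3) ∨ q = (0, 3 * k + 2)) ∧
        q.1 ≤ i * (k + 1) ∧ q.2 ≤ i) →
      {q : ℕ × ℕ | (q = (3 * k + 2, 0) ∨ q = (k + 1, 1) ∨ q = (1, 3) ∨ q = (0, 3 * k + 2)) ∧
        q ≤ i • (k + 1, 1)}.ncard = s.card := by
    intro i s hs
    rw [← Set.ncard_coe_finset]
    congr 1
    ext q
    simp [hs, Prod.le_def]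
  refine ⟨?_, ?_, fun i hi hin => ?_, fun i hi => ?_⟩
  · rw [hset 1 {(k + 1, 1)}, Finset.card_singleton]
    rintro ⟨x, y⟩
    simp only [Finset.mem_singleton, Prod.mk.injEq]
    omega
  · rw [hset 2 {(k + 1, 1)}, Finset.card_singleton]
    rintro ⟨x, y⟩
    simp only [Finset.mem_singleton, Prod.mk.injEq]
    omega
  · rw [hset i {(3 * k + 2, 0), (k + 1, 1), (1, 3)}, Finset.card_eq_three.2]
    · exact ⟨_, _, _, by simp, by simp, by simp, rfl⟩
    · rintro ⟨x, y⟩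
      have := Nat.mul_le_mul_right (k + 1) hi
      simp only [Finset.mem_insert, Finset.mem_singleton, Prod.mk.injEq]
      omega
  · rw [hset i {(3 * k + 2, 0), (k + 1, 1), (1, 3), (0, 3 * k + 2)}]
    · rw [Finset.card_insert_of_notMem (by simp), Finset.card_insert_of_notMem (by simp),
        Finset.card_pair (by simp)]
    · rintro ⟨x, y⟩
      have := Nat.mul_le_mul_right (k + 1) (show 3 ≤ i by omega)
      simp only [Finset.mem_insert, Finset.mem_singleton, Prod.mk.injEq]
      omega
end

section
/- Let H = {(x, y, z) ∈ ℕ³ : x + y = 2z}, an additive submonoid of ℕ³. Then the atoms of H are exactly the three elements α = (2, 0, 1), β = (0, 2, 1), and γ = (1, 1, 1); the only atom of H dividing γ in H is γ itself; and for every n ≥ 2, all three atoms α, β, γ divide n•γ in H. In particular, the divisor sequence of γ is s_1(γ) = 1 and s_n(γ) = 3 for all n ≥ 2. -/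
theorem mem_H19_iff {p : ℕ × ℕ × ℕ} : p ∈ H19 ↔ p.1 + p.2.1 = 2 * p.2.2 := Iff.rfl

/-- Every nonzero element of `H19` is divisible by one of the three generators. -/
theorem exists_generator_dividesIn_H19 {p : ℕ × ℕ × ℕ} (hp : p ∈ H19) (hp0 : p ≠ 0) :
    DividesIn H19 (2, 0, 1) p ∨ DividesIn H19 (0, 2, 1) p ∨ DividesIn H19 (1, 1, 1) p := by
  obtain ⟨x, y, z⟩ := p
  simp only [mem_H19_iff] at hp
  simp only [ne_eq, Prod.mk_eq_zero] at hp0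
  by_cases hx : 2 ≤ x
  · refine Or.inl ⟨(x - 2, y, z - 1), ?_, ?_⟩
    · simp only [mem_H19_iff]
      omega
    · simp only [Prod.mk_add_mk, Prod.mk.injEq]
      omega
  by_cases hy : 2 ≤ y
  · refine Or.inr (Or.inl ⟨(x, y - 2, z - 1), ?_, ?_⟩)
    · simp only [mem_H19_iff]
      omega
    · simp only [Prod.mk_add_mk, Prod.mk.injEq]
      omega
  · refine Or.inr (Or.inr ⟨0, zero_mem _, ?_⟩)
    simp only [add_zero, Prod.mk.injEq]
    omega

/-- An atom equals each of its nonzero divisors. -/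
theorem IsAtomOf.eq_of_dividesIn {M : Type*} [AddCommMonoid M] {H : AddSubmonoid M} {a b : M}
    (ha : IsAtomOf H a) (hb : b ∈ H) (hb0 : b ≠ 0) (h : DividesIn H b a) : a = b := by
  obtain ⟨c, hc, rfl⟩ := h
  rcases ha.2.2 b c hb hc rfl with h | rfl
  · exact absurd h hb0
  · exact add_zero b

/-- An element of `H19` with last coordinate `1` is an atom. -/
theorem isAtomOf_H19_of_snd_snd_eq_one {p : ℕ × ℕ × ℕ} (hp : p ∈ H19) (hz : p.2.2 = 1) :
    IsAtomOf H19 p := by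
  refine ⟨hp, by rintro rfl; simp at hz, ?_⟩
  rintro ⟨x, y, z⟩ ⟨x', y', z'⟩ hb hc rfl
  simp only [mem_H19_iff, Prod.mk_add_mk, Prod.mk_eq_zero] at *
  omega

theorem isAtomOf_H19_iff (a : ℕ × ℕ × ℕ) :
    IsAtomOf H19 a ↔ a = (2, 0, 1) ∨ a = (0, 2, 1) ∨ a = (1, 1, 1) := by
  constructor
  · intro ha
    refine (exists_generator_dividesIn_H19 ha.1 ha.2.1).imp ?_ (Or.imp ?_ ?_) <;>
      exact ha.eq_of_dividesIn (by simp [mem_H19_iff]) (by simp)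
  · rintro (rfl | rfl | rfl) <;>
      exact isAtomOf_H19_of_snd_snd_eq_one (by simp [mem_H19_iff]) rfl

theorem generators_dividesIn_nsmul {n : ℕ} (hn : 2 ≤ n) :
    DividesIn H19 (2, 0, 1) (n • ((1, 1, 1) : ℕ × ℕ × ℕ)) ∧
      DividesIn H19 (0, 2, 1) (n • ((1, 1, 1) : ℕ × ℕ × ℕ)) ∧
      DividesIn H19 (1, 1, 1) (n • ((1, 1, 1) : ℕ × ℕ × ℕ)) := by
  refine ⟨⟨(n - 2, n, n - 1), ?_, ?_⟩, ⟨(n, n - 2, n - 1), ?_, ?_⟩,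
    ⟨(n - 1, n - 1, n - 1), ?_, ?_⟩⟩ <;>
  · simp only [mem_H19_iff, Prod.smul_mk, smul_eq_mul, mul_one, Prod.mk_add_mk, Prod.mk.injEq]
    omega

theorem half_factorial_example :
    (∀ a : ℕ × ℕ × ℕ, IsAtomOf H19 a ↔
      a = (2, 0, 1) ∨ a = (0, 2, 1) ∨ a = (1, 1, 1)) ∧
    (∀ b : ℕ × ℕ × ℕ, IsAtomOf H19 b →
      DividesIn H19 b ((1, 1, 1) : ℕ × ℕ × ℕ) → b = (1, 1, 1)) ∧
    (∀ n : ℕ, 2 ≤ n →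
      DividesIn H19 ((2, 0, 1) : ℕ × ℕ × ℕ) (n • ((1, 1, 1) : ℕ × ℕ × ℕ)) ∧
      DividesIn H19 ((0, 2, 1) : ℕ × ℕ × ℕ) (n • ((1, 1, 1) : ℕ × ℕ × ℕ)) ∧
      DividesIn H19 ((1, 1, 1) : ℕ × ℕ × ℕ) (n • ((1, 1, 1) : ℕ × ℕ × ℕ))) ∧
    sSeq H19 ((1, 1, 1) : ℕ × ℕ × ℕ) 1 = 1 ∧
    (∀ n : ℕ, 2 ≤ n → sSeq H19 ((1, 1, 1) : ℕ × ℕ × ℕ) n = 3) := by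
  have hγ : IsAtomOf H19 (1, 1, 1) := (isAtomOf_H19_iff _).2 (by simp)
  have hdvd : ∀ b : ℕ × ℕ × ℕ, IsAtomOf H19 b → DividesIn H19 b (1, 1, 1) → b = (1, 1, 1) :=
    fun b hb h => (hγ.eq_of_dividesIn hb.1 hb.2.1 h).symm
  refine ⟨isAtomOf_H19_iff, hdvd, fun n hn => generators_dividesIn_nsmul hn, ?_, fun n hn => ?_⟩
  · rw [sSeq, Set.ncard_eq_one]
    refine ⟨(1, 1, 1), Set.ext fun b => ?_⟩
    rw [one_smul, Set.mem_ofPred_eq, Set.mem_singleton_iff]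
    refine ⟨fun h => hdvd b h.1 h.2, ?_⟩
    rintro rfl
    exact ⟨hγ, 0, zero_mem _, (add_zero _).symm⟩
  · obtain ⟨h₁, h₂, h₃⟩ := generators_dividesIn_nsmul hn
    rw [sSeq, Set.ncard_eq_three]
    refine ⟨(2, 0, 1), (0, 2, 1), (1, 1, 1), by simp, by simp, by simp, Set.ext fun b => ?_⟩
    simp only [Set.mem_ofPred_eq, Set.mem_insert_iff, Set.mem_singleton_iff, isAtomOf_H19_iff]
    refine ⟨And.left, fun h => ⟨h, ?_⟩⟩
    rcases h with rfl | rfl | rfl <;> assumption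
end
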